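/- arXiv:0706.3642 — 4 statements merged into one kernel-verified Lean document; each statement's English description precedes it below -/
import Mathlib

section
/- Let f₀ ∈ S(ℝ⁺) with f₀ not identically zero on (0,∞), set f(s) = s·f₀(s) and c := ∫₀^∞ |f(t)|² dt/t. Then there exist constants C > 0 and a₀ ∈ (1,2) such that for every a with 1 < a ≤ a₀, the quantities A_a := inf_{s>0} Σ_{j∈ℤ} |f(a^{2j} s)|² and B_a := sup_{s>0} Σ_{j∈ℤ} |f(a^{2j} s)|² satisfy A_a ≥ (c/(2 log a))·(1 − C·(a−1)²·|log(a−1)|) and B_a ≤ (c/(2 log a))·(1 + C·(a−1)²·|log(a−1)|). In particular 0 < A_a ≤ B_a < ∞ (the Daubechies condition holds) and B_a/A_a → 1 as a → 1⁺. -/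
open MeasureTheory Set

/-- The set of values of the Daubechies sum `Σ_{j∈ℤ} |f(a^{2j} s)|²` as `s` ranges
over `(0,∞)`. -/
noncomputable def daubSet (f : ℝ → ℂ) (a : ℝ) : Set ℝ :=
  {x | ∃ s : ℝ, 0 < s ∧ x = ∑' j : ℤ, ‖f (a ^ (2 * j) * s)‖ ^ 2}

theorem abs_trapezoid_sub_integral_le {g g' g'' : ℝ → ℝ} (hg : ∀ x, HasDerivAt g (g' x) x)
    (hg' : ∀ x, HasDerivAt g' (g'' x) x) (hc : Continuous g'') (u : ℝ) :
    |(g u + g (u + 1)) / 2 - ∫ t in u..u + 1, g t| ≤ (1 / 8) * ∫ t in u..u + 1, |g'' t| := by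
  have cg : Continuous g := continuous_iff_continuousAt.2 fun x => (hg x).continuousAt
  have h1 : ∫ t in u..u + 1, (g'' t * ((t - u) * (1 - (t - u)) / 2) + g t) =
      (g u + g (u + 1)) / 2 := by
    have hd : ∀ x, HasDerivAt
        (fun t => g' t * ((t - u) * (1 - (t - u)) / 2) - g t * ((1 - 2 * (t - u)) / 2))
        (g'' x * ((x - u) * (1 - (x - u)) / 2) + g x) x := by
      intro x
      have hx : HasDerivAt (fun t : ℝ => t - u) 1 x := (hasDerivAt_id x).sub_const u
      refine (((hg' x).mul ((hx.mul (hx.const_sub 1)).div_const 2)).sub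
        ((hg x).mul (((hx.const_mul 2).const_sub 1).div_const 2))).congr_deriv ?_
      simp only [Pi.mul_apply]
      ring
    rw [intervalIntegral.integral_eq_sub_of_hasDerivAt (fun x _ => hd x)
      ((by fun_prop : Continuous _).intervalIntegrable _ _)]
    ring
  rw [intervalIntegral.integral_add ((by fun_prop : Continuous _).intervalIntegrable _ _)
    (cg.intervalIntegrable _ _)] at h1
  rw [← h1, add_sub_cancel_right, ← intervalIntegral.integral_const_mul, ← Real.norm_eq_abs]
  refine intervalIntegral.norm_integral_le_of_norm_le (by linarith) ?_
    ((by fun_prop : Continuous _).intervalIntegrable _ _)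
  refine Filter.Eventually.of_forall fun t ht => ?_
  have h0 : 0 ≤ (t - u) * (1 - (t - u)) :=
    mul_nonneg (by linarith [ht.1]) (by linarith [ht.2])
  rw [Real.norm_eq_abs, abs_mul, abs_of_nonneg (by linarith : 0 ≤ (t - u) * (1 - (t - u)) / 2),
    mul_comm]
  refine mul_le_mul_of_nonneg_right ?_ (abs_nonneg _)
  nlinarith [sq_nonneg (2 * (t - u) - 1)]

theorem summable_and_abs_tsum_sub_integral_le {g g' g'' : ℝ → ℝ}
    (hg : ∀ x, HasDerivAt g (g' x) x) (hg' : ∀ x, HasDerivAt g' (g'' x) x)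
    (hc : Continuous g'') (h0 : ∀ x, 0 ≤ g x) (hi : Integrable g) (hi'' : Integrable g'') :
    Summable (fun n : ℤ => g n) ∧
      |∑' n : ℤ, g n - ∫ x, g x| ≤ (1 / 8) * ∫ x, |g'' x| := by
  have s1 := hi.hasSum_intervalIntegral 0
  have s2 := (hi''.abs.hasSum_intervalIntegral 0).mul_left (1 / 8)
  simp only [zero_add] at s1 s2
  have key := fun n : ℤ => abs_trapezoid_sub_integral_le hg hg' hc (n : ℝ)
  have s3 : Summable fun n : ℤ => (g n + g (n + 1)) / 2 - ∫ t in (n : ℝ)..n + 1, g t :=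
    Summable.of_norm_bounded s2.summable key
  have s4 : Summable fun n : ℤ => (g n + g (n + 1)) / 2 := by
    simpa using s3.add s1.summable
  have s5 : Summable fun n : ℤ => g n := by
    have : Summable fun n : ℤ => g n / 2 :=
      Summable.of_nonneg_of_le (fun n => by linarith [h0 n])
        (fun n => by linarith [h0 (n + 1)]) s4
    simpa using this.mul_right 2
  refine ⟨s5, ?_⟩
  have e : HasSum (fun n : ℤ => g ((n : ℝ) + 1)) (∑' n : ℤ, g n) := by
    have := (Equiv.addRight (1 : ℤ)).hasSum_iff.2 s5.hasSum
    simpa [Function.comp_def] using this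
  have e2 : HasSum (fun n : ℤ => (g n + g (n + 1)) / 2 - ∫ t in (n : ℝ)..n + 1, g t)
      (∑' n : ℤ, g n - ∫ x, g x) := by
    simpa only [add_self_div_two] using ((s5.hasSum.add e).div_const 2).sub s1
  rw [← e2.tsum_eq, ← Real.norm_eq_abs]
  exact tsum_of_norm_bounded s2 key

theorem summable_and_abs_mul_tsum_sub_integral_le {G G' G'' : ℝ → ℝ}
    (hG : ∀ x, HasDerivAt G (G' x) x) (hG' : ∀ x, HasDerivAt G' (G'' x) x)
    (hc : Continuous G'') (h0 : ∀ x, 0 ≤ G x) (hi : Integrable G) (hi'' : Integrable G'')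
    {δ : ℝ} (hδ : 0 < δ) (x : ℝ) :
    Summable (fun n : ℤ => G (δ * n + x)) ∧
      |∑' n : ℤ, G (δ * n + x) - (∫ y, G y) / δ| ≤ (δ / 8) * ∫ y, |G'' y| := by
  have hd : ∀ y, HasDerivAt (fun y => δ * y + x) δ y := fun y => by
    simpa using ((hasDerivAt_id y).const_mul δ).add_const x
  have hint : ∀ F : ℝ → ℝ, ∫ y, F (δ * y + x) = (∫ y, F y) / δ := fun F => by
    rw [Measure.integral_comp_mul_left (fun y => F (y + x)) δ, integral_add_right_eq_self,
      abs_of_pos (inv_pos.2 hδ), smul_eq_mul, inv_mul_eq_div]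
  have hI : ∀ F : ℝ → ℝ, Integrable F → Integrable fun y => F (δ * y + x) := fun F hF =>
    (hF.comp_add_right x).comp_mul_left' hδ.ne'
  obtain ⟨hs, hb⟩ := summable_and_abs_tsum_sub_integral_le (g := fun y => G (δ * y + x))
    (g' := fun y => G' (δ * y + x) * δ) (g'' := fun y => G'' (δ * y + x) * δ * δ)
    (fun y => (hG _).comp y (hd y)) (fun y => ((hG' _).comp y (hd y)).mul_const δ)
    (by fun_prop) (fun y => h0 _) (hI G hi) (((hI G'' hi'').mul_const δ).mul_const δ)
  refine ⟨hs, ?_⟩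
  rw [hint G] at hb
  refine hb.trans_eq ?_
  simp only [abs_mul, abs_of_pos hδ]
  rw [integral_mul_const, integral_mul_const, hint fun y => |G'' y|]
  field_simp

theorem integrable_exp_mul_comp_exp (h : ℝ → ℝ) :
    Integrable (fun x => Real.exp x * h (Real.exp x)) ↔ IntegrableOn h (Ioi 0) := by
  have := integrableOn_image_iff_integrableOn_abs_deriv_smul MeasurableSet.univ
    (fun x _ => (Real.hasDerivAt_exp x).hasDerivWithinAt) Real.exp_injective.injOn h
  simpa [image_univ, Real.range_exp] using this.symm

theorem integral_exp_mul_comp_exp (h : ℝ → ℝ) :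
    ∫ x, Real.exp x * h (Real.exp x) = ∫ t in Ioi 0, h t := by
  have := integral_image_eq_integral_abs_deriv_smul MeasurableSet.univ
    (fun x _ => (Real.hasDerivAt_exp x).hasDerivWithinAt) Real.exp_injective.injOn h
  simpa [image_univ, Real.range_exp] using this.symm

open SchwartzMap in
theorem exists_schwartz_hasDerivAt_exp_mul_comp_exp (χ : SchwartzMap ℝ ℝ) :
    ∃ η : SchwartzMap ℝ ℝ, ∀ x, HasDerivAt (fun x => Real.exp x * χ (Real.exp x))
      (Real.exp x * η (Real.exp x)) x := by
  have hid : (fun t : ℝ => t).HasTemperateGrowth := by fun_prop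
  refine ⟨derivCLM ℝ ℝ (smulLeftCLM ℝ (fun t : ℝ => t) χ), fun x => ?_⟩
  have h := ((smulLeftCLM ℝ (fun t : ℝ => t) χ).hasDerivAt (Real.exp x)).comp x
    (Real.hasDerivAt_exp x)
  simpa [Function.comp_def, smulLeftCLM_apply hid, mul_comm] using h

open SchwartzMap in
theorem exists_schwartz_eq_mul_norm_sq (f₀ : SchwartzMap ℝ ℂ) :
    ∃ χ : SchwartzMap ℝ ℝ, ∀ t, χ t = t * ‖f₀ t‖ ^ 2 := by
  have hid : (fun t : ℝ => t).HasTemperateGrowth := by fun_prop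
  refine ⟨smulLeftCLM ℝ (fun t : ℝ => t) (pairing (innerSL ℝ) f₀ f₀), fun t => ?_⟩
  rw [smulLeftCLM_apply_apply hid, pairing_apply_apply, smul_eq_mul]
  exact congrArg (t * ·) (real_inner_self_eq_norm_sq (f₀ t))

theorem exists_abs_daubechies_sum_sub_le (f₀ : SchwartzMap ℝ ℂ) (hf₀ : ∃ s : ℝ, 0 < s ∧ f₀ s ≠ 0)
    (f : ℝ → ℂ) (hf : ∀ s : ℝ, f s = (s : ℂ) * f₀ s) :
    0 < ∫ t in Ioi (0 : ℝ), ‖f t‖ ^ 2 / t ∧ ∃ K : ℝ, 0 ≤ K ∧ ∀ a : ℝ, 1 < a → ∀ s : ℝ, 0 < s →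
      |∑' j : ℤ, ‖f (a ^ (2 * j) * s)‖ ^ 2 -
        (∫ t in Ioi (0 : ℝ), ‖f t‖ ^ 2 / t) / (2 * Real.log a)| ≤ K * (2 * Real.log a) := by
  obtain ⟨χ, hχ⟩ := exists_schwartz_eq_mul_norm_sq f₀
  obtain ⟨χ₁, hχ₁⟩ := exists_schwartz_hasDerivAt_exp_mul_comp_exp χ
  obtain ⟨χ₂, hχ₂⟩ := exists_schwartz_hasDerivAt_exp_mul_comp_exp χ₁
  have hfn : ∀ t, ‖f t‖ ^ 2 = t * χ t := fun t => by
    rw [hf, hχ, norm_mul, Complex.norm_real, mul_pow, Real.norm_eq_abs, sq_abs]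
    ring
  have hc : ∫ t in Ioi (0 : ℝ), ‖f t‖ ^ 2 / t = ∫ x, Real.exp x * χ (Real.exp x) := by
    rw [integral_exp_mul_comp_exp]
    refine setIntegral_congr_fun measurableSet_Ioi fun t ht => ?_
    simp only [hfn]
    exact mul_div_cancel_left₀ _ (ne_of_gt ht)
  have hI : ∀ η : SchwartzMap ℝ ℝ, Integrable fun x => Real.exp x * η (Real.exp x) := fun η =>
    (integrable_exp_mul_comp_exp _).2 η.integrable.integrableOn
  have hC : ∀ η : SchwartzMap ℝ ℝ, Continuous fun x => Real.exp x * η (Real.exp x) := fun η =>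
    Real.continuous_exp.mul (η.continuous.comp Real.continuous_exp)
  have h0 : ∀ x, 0 ≤ Real.exp x * χ (Real.exp x) := fun x => by
    rw [← hfn]; positivity
  refine ⟨?_, (1 / 8) * ∫ x, |Real.exp x * χ₂ (Real.exp x)|,
    mul_nonneg (by norm_num) (integral_nonneg fun x => abs_nonneg _), fun a ha s hs => ?_⟩
  · obtain ⟨s, hs, hne⟩ := hf₀
    rw [hc]
    refine integral_pos_of_integrable_nonneg_nonzero (x := Real.log s) (hC χ) (hI χ) h0 ?_
    rw [Real.exp_log hs, hχ]
    have := norm_ne_zero_iff.2 hne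
    positivity
  · have hδ : 0 < 2 * Real.log a := mul_pos two_pos (Real.log_pos ha)
    have h := (summable_and_abs_mul_tsum_sub_integral_le hχ₁ hχ₂ (hC χ₂) h0 (hI χ) (hI χ₂) hδ
      (Real.log s)).2
    have he : ∀ j : ℤ, Real.exp (2 * Real.log a * j + Real.log s) = a ^ (2 * j) * s := fun j => by
      rw [Real.exp_add, Real.exp_log hs, ← Real.rpow_intCast, Real.rpow_def_of_pos (by linarith)]
      push_cast
      ring_nf
    rw [← hc] at h
    simp only [he, ← hfn] at h
    refine h.trans_eq ?_
    ring

/-- Daubechies' condition: for `f(s) = s·f₀(s)` with `f₀ ∈ S(ℝ⁺)` not identically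
zero on `(0,∞)` and `c = ∫₀^∞ |f(t)|² dt/t`, there are `C > 0` and `a₀ ∈ (1,2)`
such that for `1 < a ≤ a₀` the infimum `A_a` and supremum `B_a` of the Daubechies
sums exist (in particular `0 < A_a ≤ B_a < ∞`) and satisfy
`A_a ≥ (c/(2 log a))(1 − C (a−1)² |log(a−1)|)`,
`B_a ≤ (c/(2 log a))(1 + C (a−1)² |log(a−1)|)`; moreover `B_a/A_a → 1` as `a → 1⁺`. -/
theorem stmt2 (f₀ : SchwartzMap ℝ ℂ) (hf₀ : ∃ s : ℝ, 0 < s ∧ f₀ s ≠ 0)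
    (f : ℝ → ℂ) (hf : ∀ s : ℝ, f s = (s : ℂ) * f₀ s)
    (c : ℝ) (hc : c = ∫ t in Ioi (0 : ℝ), ‖f t‖ ^ 2 / t) :
    ∃ C > (0 : ℝ), ∃ a₀ : ℝ, 1 < a₀ ∧ a₀ < 2 ∧
      (∀ a : ℝ, 1 < a → a ≤ a₀ →
        IsGLB (daubSet f a) (sInf (daubSet f a)) ∧
        IsLUB (daubSet f a) (sSup (daubSet f a)) ∧
        c / (2 * Real.log a) * (1 - C * (a - 1) ^ 2 * |Real.log (a - 1)|) ≤
          sInf (daubSet f a) ∧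
        sSup (daubSet f a) ≤
          c / (2 * Real.log a) * (1 + C * (a - 1) ^ 2 * |Real.log (a - 1)|) ∧
        0 < sInf (daubSet f a) ∧ sInf (daubSet f a) ≤ sSup (daubSet f a)) ∧
      Filter.Tendsto (fun a : ℝ => sSup (daubSet f a) / sInf (daubSet f a))
        (nhdsWithin 1 (Ioi 1)) (nhds 1) := by
  obtain ⟨hcpos, K, hK, hS⟩ := exists_abs_daubechies_sum_sub_le f₀ hf₀ f hf
  rw [← hc] at hcpos hS
  set C : ℝ := 4 * K / c + 1 with hCdef
  have hC1 : 1 ≤ C := by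
    have : 0 ≤ 4 * K / c := by positivity
    linarith
  have hbd : ∀ a : ℝ, 1 < a → ∀ x ∈ daubSet f a,
      |x - c / (2 * Real.log a)| ≤ c / (2 * Real.log a) * (C * (a - 1) ^ 2) := by
    rintro a ha x ⟨s, hs, rfl⟩
    have hl : 0 < Real.log a := Real.log_pos ha
    have hl' : Real.log a ≤ a - 1 := Real.log_le_sub_one_of_pos (by linarith)
    calc _ ≤ K * (2 * Real.log a) := hS a ha s hs
      _ = c / (2 * Real.log a) * (4 * K / c * Real.log a ^ 2) := by
        field_simp
        norm_num
      _ ≤ c / (2 * Real.log a) * (C * (a - 1) ^ 2) := by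
        gcongr
        linarith
  have hne : ∀ a, (daubSet f a).Nonempty := fun a => ⟨_, 1, one_pos, rfl⟩
  have hbelow : ∀ a, BddBelow (daubSet f a) := fun a =>
    ⟨0, by rintro x ⟨s, -, rfl⟩; exact tsum_nonneg fun _ => by positivity⟩
  have habove : ∀ a, 1 < a → BddAbove (daubSet f a) := fun a ha =>
    ⟨_, fun x hx => sub_le_iff_le_add.1 ((le_abs_self _).trans (hbd a ha x hx))⟩
  have hinf : ∀ a, 1 < a → c / (2 * Real.log a) * (1 - C * (a - 1) ^ 2) ≤ sInf (daubSet f a) :=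
    fun a ha => le_csInf (hne a) fun x hx => by linarith [(abs_le.1 (hbd a ha x hx)).1]
  have hsup : ∀ a, 1 < a → sSup (daubSet f a) ≤ c / (2 * Real.log a) * (1 + C * (a - 1) ^ 2) :=
    fun a ha => csSup_le (hne a) fun x hx => by linarith [(abs_le.1 (hbd a ha x hx)).2]
  have hle : ∀ a, 1 < a → sInf (daubSet f a) ≤ sSup (daubSet f a) := fun a ha =>
    csInf_le_csSup (hne a) (hbelow a) (habove a ha)
  have hcl : ∀ a, 1 < a → 0 < c / (2 * Real.log a) := fun a ha =>
    div_pos hcpos (mul_pos two_pos (Real.log_pos ha))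
  set r : ℝ := 1 / (4 * C) with hr
  have hr0 : 0 < r := by positivity
  have hrC : C * r = 1 / 4 := by rw [hr]; field_simp
  have hr1 : r ≤ 1 / 4 := by nlinarith
  have hsmall : ∀ a, 1 < a → a ≤ 1 + r → C * (a - 1) ^ 2 ≤ 1 / 16 := fun a ha har => by
    have h1 : C * (a - 1) ≤ 1 / 4 := hrC ▸ by gcongr; linarith
    nlinarith
  refine ⟨C, by linarith, 1 + r, by linarith, by linarith, fun a ha har => ?_, ?_⟩
  · have hlog : 1 ≤ |Real.log (a - 1)| := by
      refine le_abs.2 (Or.inr ?_)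
      rw [le_neg, Real.log_le_iff_le_exp (by linarith), Real.exp_neg]
      have h4 : (4 : ℝ)⁻¹ ≤ (Real.exp 1)⁻¹ :=
        inv_anti₀ (Real.exp_pos 1) (by linarith [Real.exp_one_lt_d9])
      linarith
    have hmul : C * (a - 1) ^ 2 ≤ C * (a - 1) ^ 2 * |Real.log (a - 1)| :=
      le_mul_of_one_le_right (by positivity) hlog
    have hs := hsmall a ha har
    have hp := hcl a ha
    refine ⟨isGLB_csInf (hne a) (hbelow a), isLUB_csSup (hne a) (habove a ha),
      le_trans (by gcongr) (hinf a ha), (hsup a ha).trans (by gcongr),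
      lt_of_lt_of_le (mul_pos hp (by linarith)) (hinf a ha), hle a ha⟩
  · have hev : ∀ᶠ a in nhdsWithin (1 : ℝ) (Ioi 1), 1 < a ∧ a ≤ 1 + r := by
      filter_upwards [Ioc_mem_nhdsGT (show (1 : ℝ) < 1 + r by linarith)] with a h using h
    have hlim : Filter.Tendsto (fun a : ℝ => (1 + C * (a - 1) ^ 2) / (1 - C * (a - 1) ^ 2))
        (nhdsWithin 1 (Ioi 1)) (nhds 1) := by
      have hcont : ContinuousAt
          (fun a : ℝ => (1 + C * (a - 1) ^ 2) / (1 - C * (a - 1) ^ 2)) 1 :=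
        ContinuousAt.div (by fun_prop) (by fun_prop) (by simp)
      simpa using hcont.tendsto.mono_left nhdsWithin_le_nhds
    refine tendsto_of_tendsto_of_tendsto_of_le_of_le' tendsto_const_nhds hlim ?_ ?_
    · filter_upwards [hev] with a ⟨ha, har⟩
      have hpos : 0 < sInf (daubSet f a) :=
        (mul_pos (hcl a ha) (by linarith [hsmall a ha har])).trans_le (hinf a ha)
      exact (one_le_div hpos).2 (hle a ha)
    · filter_upwards [hev] with a ⟨ha, har⟩
      have hp := hcl a ha
      have hs : 0 < 1 - C * (a - 1) ^ 2 := by linarith [hsmall a ha har]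
      rw [← mul_div_mul_left (1 + C * (a - 1) ^ 2) _ hp.ne']
      exact div_le_div₀ (mul_nonneg hp.le (by positivity)) (hsup a ha) (mul_pos hp hs) (hinf a ha)
end

section
/- Let X be a compact metric space equipped with a Borel measure μ, let n ≥ 1 be an integer, and suppose there exist constants c₃, δ > 0 such that μ(B(x,r)) ≥ c₃·rⁿ for every x ∈ X and every 0 < r ≤ δ. Then for every t with 0 < t ≤ δ there exist a positive integer N and pairwise disjoint Borel sets E₁, …, E_N whose union is X, such that each E_k has diameter at most 4t and μ(E_k) ≥ c₃·tⁿ. -/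
open MeasureTheory Set

open scoped NNReal

/-- A compact metric space has a finite set of points that are pairwise more than `2 * r` apart and
whose closed balls of radius `2 * r` cover the space. -/
theorem exists_finite_isSeparated_isCover {X : Type*} [MetricSpace X] [CompactSpace X]
    {r : ℝ≥0} (hr : r ≠ 0) :
    ∃ S : Set X, S.Finite ∧ Metric.IsSeparated ↑(2 * r) S ∧
      Metric.IsCover (2 * r) Set.univ S := by
  have hfin : Metric.packingNumber (2 * r) (Set.univ : Set X) ≠ ⊤ := by
    obtain ⟨C, -, hC, hcov⟩ := Metric.exists_finite_isCover_of_isCompact hr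
      (isCompact_univ : IsCompact (Set.univ : Set X))
    refine ne_top_of_le_ne_top (encard_ne_top_iff.mpr hC) ?_
    exact (Metric.packingNumber_two_mul_le_externalCoveringNumber r _).trans
      hcov.externalCoveringNumber_le_encard
  refine ⟨Metric.maximalSeparatedSet (2 * r) Set.univ, ?_,
    Metric.isSeparated_maximalSeparatedSet, Metric.isCover_maximalSeparatedSet hfin⟩
  rwa [← encard_ne_top_iff, Metric.encard_maximalSeparatedSet hfin]

/-- A finite cover by measurable sets `V k`, containing pairwise disjoint measurable sets `U k`,
can be refined to a measurable partition with pieces lying between `U k` and `V k`. -/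
theorem exists_measurable_partition_between {X : Type*} [MeasurableSpace X] {N : ℕ}
    {U V : Fin N → Set X} (hU : ∀ k, MeasurableSet (U k)) (hV : ∀ k, MeasurableSet (V k))
    (hUV : ∀ k, U k ⊆ V k) (hdisj : Pairwise (Function.onFun Disjoint U))
    (hcov : ⋃ k, V k = Set.univ) :
    ∃ E : Fin N → Set X, (∀ k, MeasurableSet (E k)) ∧ Pairwise (Function.onFun Disjoint E) ∧
      ⋃ k, E k = Set.univ ∧ ∀ k, U k ⊆ E k ∧ E k ⊆ V k := by
  let A : Fin N → Set X := fun k => V k \ ⋃ j, ⋃ _ : j ≠ k, U j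
  have hA : ∀ k, MeasurableSet (A k) := fun k =>
    (hV k).diff (.iUnion fun j => .iUnion fun _ => hU j)
  refine ⟨disjointed A, fun k => disjointedRec (fun _ i h => h.diff (hA i)) (hA k),
    disjoint_disjointed A, ?_, fun k => ⟨fun x hx => ?_, (disjointed_subset A k).trans sdiff_subset⟩⟩
  · rw [iUnion_disjointed, eq_univ_iff_forall]
    intro x
    by_cases hx : ∃ k, x ∈ U k
    · obtain ⟨k, hk⟩ := hx
      refine mem_iUnion.mpr ⟨k, hUV k hk, ?_⟩
      simp only [mem_iUnion, not_exists]
      exact fun j hj hxj => (hdisj hj).le_bot ⟨hxj, hk⟩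
    · obtain ⟨k, hk⟩ := mem_iUnion.mp (hcov.ge (mem_univ x))
      refine mem_iUnion.mpr ⟨k, hk, ?_⟩
      simp only [mem_iUnion, not_exists]
      exact fun j _ hxj => hx ⟨j, hxj⟩
  · rw [disjointed_eq_inter_compl]
    refine ⟨⟨hUV k hx, ?_⟩, ?_⟩
    · simp only [mem_iUnion, not_exists]
      exact fun j hj hxj => (hdisj hj).le_bot ⟨hxj, hx⟩
    · simp only [mem_iInter]
      exact fun j hj hxj => hxj.2 (mem_iUnion₂.mpr ⟨k, hj.ne', hx⟩)

/-- A compact metric space with a Borel measure satisfying the lower ball bound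
`μ(B(x,r)) ≥ c₃ rⁿ` for `0 < r ≤ δ` can be written, for any `0 < t ≤ δ`, as a
finite disjoint union of Borel sets each of diameter at most `4t` and measure at
least `c₃ tⁿ`. -/
theorem stmt8 {X : Type*} [MetricSpace X] [CompactSpace X] [Nonempty X]
    [MeasurableSpace X] [BorelSpace X] (μ : Measure X)
    (n : ℕ) (hn : 1 ≤ n) (c₃ δ : ℝ) (hc₃ : 0 < c₃) (hδ : 0 < δ)
    (hμ : ∀ (x : X) (r : ℝ), 0 < r → r ≤ δ →
      ENNReal.ofReal (c₃ * r ^ n) ≤ μ (Metric.ball x r))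
    (t : ℝ) (ht : 0 < t) (htδ : t ≤ δ) :
    ∃ N : ℕ, 0 < N ∧ ∃ E : Fin N → Set X,
      (∀ k, MeasurableSet (E k)) ∧
      Pairwise (Function.onFun Disjoint E) ∧
      (⋃ k, E k) = Set.univ ∧
      ∀ k, EMetric.diam (E k) ≤ ENNReal.ofReal (4 * t) ∧
        ENNReal.ofReal (c₃ * t ^ n) ≤ μ (E k) := by
  lift t to ℝ≥0 using ht.le
  have ht0 : t ≠ 0 := by rintro rfl; simp at ht
  obtain ⟨S, hfin, hsep, hcov⟩ := exists_finite_isSeparated_isCover (X := X) ht0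
  obtain ⟨N, c, hc, rfl⟩ := hfin.fin_param
  obtain ⟨E, hE, hdisj, hunion, hbetween⟩ := exists_measurable_partition_between
    (U := fun k => Metric.ball (c k) t) (V := fun k => Metric.closedBall (c k) (2 * t))
    (fun _ => measurableSet_ball) (fun _ => Metric.isClosed_closedBall.measurableSet)
    (fun k => Metric.ball_subset_closedBall.trans
      (Metric.closedBall_subset_closedBall (by linarith)))
    (fun i j hij => by
      have h : ↑(2 * t) < edist (c i) (c j) := hsep (mem_range_self i) (mem_range_self j) (hc.ne hij)
      rw [edist_nndist, ENNReal.coe_lt_coe, ← NNReal.coe_lt_coe, coe_nndist] at h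
      push_cast at h
      exact Metric.ball_disjoint_ball (by linarith))
    (by simpa [eq_univ_iff_forall, subset_def] using hcov.subset_iUnion_closedBall)
  refine ⟨N, ?_, E, hE, hdisj, hunion, fun k => ⟨?_, ?_⟩⟩
  · obtain ⟨k, -⟩ := mem_iUnion.mp (hunion.ge (mem_univ (Classical.arbitrary X)))
    exact k.pos
  · refine Metric.ediam_le fun x hx y hy => ?_
    rw [edist_dist]
    refine ENNReal.ofReal_le_ofReal ((dist_triangle_right x y (c k)).trans ?_)
    have hxk := Metric.mem_closedBall.mp ((hbetween k).2 hx)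
    have hyk := Metric.mem_closedBall.mp ((hbetween k).2 hy)
    linarith
  · exact (hμ (c k) t ht htδ).trans (measure_mono (hbetween k).1)
end

section
/- Let a > 1, b > 0, and M > 1/2, and let f(s) = s·e^{−s}. Then Σ_{j ∈ ℤ, a^{2(j−1)} > M/b} |f(b·a^{2j})|² ≤ (a²/(a²−1))·e^{−2M}·(M/2 + 1/4). -/
open Set

/-- An antiderivative of `-(t e^{-2t})`. -/
noncomputable def expTail (t : ℝ) : ℝ := Real.exp (-2 * t) * (t / 2 + 1 / 4)

lemma mul_exp_le_expTail_sub {s t : ℝ} (hs : 1 / 2 ≤ s) (hst : s ≤ t) :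
    (t - s) * (t * Real.exp (-2 * t)) ≤ expTail s - expTail t := by
  obtain ⟨d, hd, rfl⟩ : ∃ d, 0 ≤ d ∧ t = s + d := ⟨t - s, by linarith, by ring⟩
  have hquad := Real.quadratic_le_exp_of_nonneg (x := 2 * d) (by linarith)
  have hexp : Real.exp (-2 * s) = Real.exp (-2 * (s + d)) * Real.exp (2 * d) := by
    rw [← Real.exp_add]; ring_nf
  have hpoly : d * (s + d) ≤ Real.exp (2 * d) * (s / 2 + 1 / 4) - ((s + d) / 2 + 1 / 4) := by
    have h1 := mul_le_mul_of_nonneg_right hquad (by linarith : 0 ≤ s / 2 + 1 / 4)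
    have h2 : 0 ≤ d ^ 2 * (s - 1 / 2) := mul_nonneg (sq_nonneg d) (by linarith)
    linarith
  have h := mul_le_mul_of_nonneg_left hpoly (Real.exp_pos (-2 * (s + d))).le
  rw [expTail, expTail, hexp]
  linarith

lemma expTail_anti {s t : ℝ} (hs : 1 / 2 ≤ s) (hst : s ≤ t) : expTail t ≤ expTail s := by
  have h := mul_exp_le_expTail_sub hs hst
  have : 0 ≤ (t - s) * (t * Real.exp (-2 * t)) :=
    mul_nonneg (by linarith) (mul_nonneg (by linarith) (Real.exp_pos _).le)
  linarith

lemma sq_mul_exp_le_expTail_sub {q s : ℝ} (hq : 1 < q) (hs : 1 / 2 ≤ s) :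
    (q * s * Real.exp (-(q * s))) ^ 2 ≤ q / (q - 1) * (expTail s - expTail (q * s)) := by
  have hq' : 0 < q - 1 := by linarith
  have h := mul_exp_le_expTail_sub hs (le_mul_of_one_le_left (by linarith) hq.le : s ≤ q * s)
  have hexp : Real.exp (-(q * s)) ^ 2 = Real.exp (-2 * (q * s)) := by
    rw [← Real.exp_nat_mul]; push_cast; ring_nf
  calc (q * s * Real.exp (-(q * s))) ^ 2
      = q / (q - 1) * ((q * s - s) * (q * s * Real.exp (-2 * (q * s)))) := by
        rw [mul_pow, hexp]; field_simp
    _ ≤ _ := by gcongr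

lemma sum_sq_mul_exp_le {q b M : ℝ} (hq : 1 < q) (hb : 0 < b) (hM : 1 / 2 ≤ M) (F : Finset ℤ) :
    (∀ j ∈ F, M ≤ b * q ^ (j - 1)) → ∀ r, M ≤ r → (∀ j ∈ F, b * q ^ j ≤ r) →
      ∑ j ∈ F, (b * q ^ j * Real.exp (-(b * q ^ j))) ^ 2 ≤
        q / (q - 1) * (expTail M - expTail r) := by
  have hq' : 0 < q - 1 := by linarith
  have hc : 0 ≤ q / (q - 1) := by positivity
  induction F using Finset.induction_on_max with
  | empty =>
    intro _ r hr _
    simpa using mul_nonneg hc (sub_nonneg.2 (expTail_anti hM hr))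
  | insert j s hlt ih =>
    intro hF r _ hr
    have hj := hF j (Finset.mem_insert_self j s)
    have hstep : b * q ^ j = q * (b * q ^ (j - 1)) := by
      rw [zpow_sub_one₀ (by positivity)]; field_simp
    have hprev := ih (fun i hi => hF i (Finset.mem_insert_of_mem hi)) _ hj fun i hi => by
      have : i ≤ j - 1 := by have := hlt i hi; omega
      gcongr
      exact hq.le
    have hterm := sq_mul_exp_le_expTail_sub hq (hM.trans hj)
    rw [← hstep] at hterm
    have hjr := hr j (Finset.mem_insert_self j s)
    have hle : b * q ^ (j - 1) ≤ b * q ^ j := by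
      rw [hstep]; exact le_mul_of_one_le_left (by positivity) hq.le
    have hlast := mul_le_mul_of_nonneg_left
      (expTail_anti (hM.trans (hj.trans hle)) hjr) hc
    rw [Finset.sum_insert fun h => (hlt j h).false]
    linarith

lemma sum_sq_mul_exp_le_expTail {q b M : ℝ} (hq : 1 < q) (hb : 0 < b) (hM : 1 / 2 ≤ M)
    (F : Finset ℤ) (hF : ∀ j ∈ F, M ≤ b * q ^ (j - 1)) :
    ∑ j ∈ F, (b * q ^ j * Real.exp (-(b * q ^ j))) ^ 2 ≤ q / (q - 1) * expTail M := by
  have hq' : 0 < q - 1 := by linarith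
  obtain ⟨R, hR⟩ := (F.image fun j => b * q ^ j).bddAbove
  have h := sum_sq_mul_exp_le hq hb hM F hF (max M R) (le_max_left _ _) fun j hj =>
    (hR (Finset.mem_image_of_mem _ hj)).trans (le_max_right _ _)
  have hpos : 0 ≤ expTail (max M R) := by
    have : M ≤ max M R := le_max_left _ _
    exact mul_nonneg (Real.exp_pos _).le (by linarith)
  refine h.trans ?_
  gcongr
  linarith

/-- For `f(s) = s e^{−s}`, `a > 1`, `b > 0` and `M > 1/2`,
`Σ_{j : a^{2(j−1)} > M/b} |f(b a^{2j})|² ≤ (a²/(a²−1)) e^{−2M} (M/2 + 1/4)`. -/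
theorem stmt17 (a b M : ℝ) (ha : 1 < a) (hb : 0 < b) (hM : 1 / 2 < M)
    (f : ℝ → ℝ) (hf : ∀ s : ℝ, f s = s * Real.exp (-s)) :
    Summable (fun j : {j : ℤ // M / b < a ^ (2 * (j - 1))} =>
      f (b * a ^ (2 * (j : ℤ))) ^ 2) ∧
    (∑' j : {j : ℤ // M / b < a ^ (2 * (j - 1))}, f (b * a ^ (2 * (j : ℤ))) ^ 2) ≤
      a ^ 2 / (a ^ 2 - 1) * Real.exp (-2 * M) * (M / 2 + 1 / 4) := by
  have hpow (k : ℤ) : a ^ (2 * k) = (a ^ 2) ^ k := by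
    rw [zpow_mul]; norm_cast
  have hbound (u : Finset {j : ℤ // M / b < a ^ (2 * (j - 1))}) :
      ∑ j ∈ u, f (b * a ^ (2 * (j : ℤ))) ^ 2 ≤
        a ^ 2 / (a ^ 2 - 1) * Real.exp (-2 * M) * (M / 2 + 1 / 4) := by
    have h := sum_sq_mul_exp_le_expTail (one_lt_pow₀ ha two_ne_zero) hb hM.le
      (u.map (Function.Embedding.subtype _)) fun j hj => by
        obtain ⟨i, -, rfl⟩ := Finset.mem_map.1 hj
        have hi := i.2
        rw [hpow, div_lt_iff₀' hb] at hi
        exact hi.le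
    rw [Finset.sum_map] at h
    simpa only [hf, hpow, expTail, mul_assoc, Function.Embedding.subtype_apply] using h
  have hsum := summable_of_sum_le (fun _ => sq_nonneg _) hbound
  exact ⟨hsum, hsum.tsum_le_of_sum_le hbound⟩
end

section
/- Let a > 1, let n ≥ 1 and l ≥ 1 be integers, and let N, r be reals with N ≥ 2, r ≥ 1, r·(l+n−1) ≥ 2, and l+n−1 ≥ log_a l. Then there is a unique real number m such that a^{2m}·l·(l+n−1) = N + r·max(−m, 0), and it satisfies (1/2)·log_a(N/(l·(l+n−1))) ≤ m ≤ (1/2)·log_a(r·N/l). -/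
open Real

/-- Raising `a` to twice half of `log_a x` recovers `x`. -/
theorem rpow_two_mul_half_log_div_log {a x : ℝ} (ha : 1 < a) (hx : 0 < x) :
    a ^ (2 * (1 / 2 * (Real.log x / Real.log a))) = x := by
  rw [← mul_assoc, show (2 : ℝ) * (1 / 2) = 1 by norm_num, one_mul]
  exact Real.rpow_logb (by linarith) ha.ne' hx

/-- An exponential with base `a > 1`, minus a nonnegative multiple of the negative part, is strictly
increasing. -/
theorem strictMono_rpow_mul_sub_negPart {a c r : ℝ} (ha : 1 < a) (hc : 0 < c) (hr : 0 ≤ r) :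
    StrictMono fun m : ℝ => a ^ (2 * m) * c - r * max (-m) 0 := by
  intro x y hxy
  have h1 : a ^ (2 * x) * c < a ^ (2 * y) * c :=
    mul_lt_mul_of_pos_right (Real.rpow_lt_rpow_of_exponent_lt ha (by linarith)) hc
  have h2 : r * max (-y) 0 ≤ r * max (-x) 0 :=
    mul_le_mul_of_nonneg_left (max_le_max (by linarith) le_rfl) hr
  dsimp only
  linarith

/-- Crude estimate for the solution `m` of `a^{2m} l(l+n−1) = N + r·max(−m,0)`:
under the stated hypotheses the solution exists, is unique, and satisfies
`(1/2) log_a(N/(l(l+n−1))) ≤ m ≤ (1/2) log_a(rN/l)`. -/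
theorem stmt19 (a : ℝ) (ha : 1 < a) (n l : ℕ) (hn : 1 ≤ n) (hl : 1 ≤ l)
    (N r : ℝ) (hN : 2 ≤ N) (hr : 1 ≤ r) (hrl : 2 ≤ r * ((l : ℝ) + n - 1))
    (hlog : Real.log l / Real.log a ≤ (l : ℝ) + n - 1) :
    ∃ m : ℝ,
      a ^ (2 * m) * ((l : ℝ) * ((l : ℝ) + n - 1)) = N + r * max (-m) 0 ∧
      (∀ m' : ℝ,
        a ^ (2 * m') * ((l : ℝ) * ((l : ℝ) + n - 1)) = N + r * max (-m') 0 → m' = m) ∧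
      1 / 2 * (Real.log (N / ((l : ℝ) * ((l : ℝ) + n - 1))) / Real.log a) ≤ m ∧
      m ≤ 1 / 2 * (Real.log (r * N / l) / Real.log a) := by
  have hl1 : (1 : ℝ) ≤ l := by exact_mod_cast hl
  have hn1 : (1 : ℝ) ≤ n := by exact_mod_cast hn
  have hK : (1 : ℝ) ≤ (l : ℝ) + n - 1 := by linarith
  generalize (l : ℝ) + n - 1 = K at *
  have hl0 : (0 : ℝ) < l := by linarith
  have hlK : 0 < (l : ℝ) * K := by positivity
  have hloga : 0 < Real.log a := Real.log_pos ha
  have hrN : 1 ≤ r * N := by nlinarith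
  have hmono := strictMono_rpow_mul_sub_negPart ha hlK (by linarith : 0 ≤ r)
  have hcont : Continuous fun m : ℝ => a ^ (2 * m) * ((l : ℝ) * K) - r * max (-m) 0 := by
    have : Continuous fun m : ℝ => a ^ (2 * m) :=
      continuous_const.rpow (by fun_prop) fun _ => Or.inl (by linarith)
    fun_prop
  set m₀ := 1 / 2 * (Real.log (N / ((l : ℝ) * K)) / Real.log a) with hm₀
  set m₁ := 1 / 2 * (Real.log (r * N / l) / Real.log a) with hm₁
  have hlow : a ^ (2 * m₀) * ((l : ℝ) * K) - r * max (-m₀) 0 ≤ N := by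
    rw [hm₀, rpow_two_mul_half_log_div_log ha (by positivity), div_mul_cancel₀ _ hlK.ne']
    have : 0 ≤ r * max (-m₀) 0 := mul_nonneg (by linarith) (le_max_right _ _)
    linarith
  have hneg : max (-m₁) 0 ≤ K / 2 := by
    refine max_le ?_ (by linarith)
    have h : 0 ≤ Real.log (r * N) / Real.log a := div_nonneg (Real.log_nonneg hrN) hloga.le
    rw [hm₁, Real.log_div (by positivity) hl0.ne', sub_div]
    linarith
  have hupp : N ≤ a ^ (2 * m₁) * ((l : ℝ) * K) - r * max (-m₁) 0 := by
    have hval : a ^ (2 * m₁) * ((l : ℝ) * K) = N * (r * K) := by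
      rw [hm₁, rpow_two_mul_half_log_div_log ha (by positivity)]
      field_simp
    have h : r * max (-m₁) 0 ≤ r * (K / 2) := mul_le_mul_of_nonneg_left hneg (by linarith)
    rw [hval]
    nlinarith
  have hle : m₀ ≤ m₁ := hmono.le_iff_le.mp (hlow.trans hupp)
  obtain ⟨m, hm, hmN⟩ := intermediate_value_Icc hle hcont.continuousOn ⟨hlow, hupp⟩
  dsimp only at hmN
  refine ⟨m, by linarith, fun m' hm' => hmono.injective ?_, hm.1, hm.2⟩
  linarith
end
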